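/- arXiv:1611.03044 — 7 statements merged into one kernel-verified Lean document; each statement's English description precedes it below -/
import Mathlib

section
/- Core characterization (Lemma 1): let L ⊆ Z be a finite set of participants and assume truthful bidding. The VCG outcome (u_0(L), (u_j(L))_{j∈L}) lies in the core of the coalitional game (L,w) if and only if for every subset K of the winners W(L): Σ_{j∈K} (J*(L∖{j}) − J*(L)) ≤ J*(L∖K) − J*(L). -/
/-!
STATEMENT 3: Core characterization (Lemma 1 of Sessa, Walton, Kamgarpour).

`Z` is a finite set of potential participants and `Jstar` gives the auctioneer's
optimal procurement cost for each subset of participants; adding participants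
cannot increase the cost.  For a set `L ⊆ Z` of participants, truthful bidding
and Clarke pivot payments give utilities `u j = Jstar (L \ {j}) - Jstar L` for
`j ∈ L` and `u₀ = -Jstar L - ∑_{j ∈ L} u j` for the auctioneer; the winners are
`W = {j ∈ L : u j > 0}`.

The outcome lies in the core of the coalitional game `(L, w)` — i.e. every
coalition `S ⊆ L ∪ {0}` is unblocked: `-Jstar S ≤ u₀ + ∑_{j ∈ S} u j` for
coalitions containing the auctioneer and `0 ≤ ∑_{j ∈ S} u j` for the others
(the efficiency equality `u₀ + ∑_{j ∈ L} u j = -Jstar L` holds by definition) —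
if and only if for every subset `K` of the winners `W`:
`∑_{j ∈ K} (Jstar (L \ {j}) - Jstar L) ≤ Jstar (L \ K) - Jstar L`.
-/

theorem vcg_core_characterization
    {α : Type*} [DecidableEq α] (Z : Finset α)
    (Jstar : Finset α → ℝ)
    (hmono : ∀ S S' : Finset α, S ⊆ S' → S' ⊆ Z → Jstar S' ≤ Jstar S)
    (L : Finset α) (hLZ : L ⊆ Z)
    (u : α → ℝ) (hu : ∀ j ∈ L, u j = Jstar (L.erase j) - Jstar L)
    (u0 : ℝ) (hu0 : u0 = -Jstar L - ∑ j ∈ L, u j)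
    (W : Finset α)
    (hW : W = L.filter (fun j => 0 < Jstar (L.erase j) - Jstar L)) :
    ((∀ S ⊆ L, -Jstar S ≤ u0 + ∑ j ∈ S, u j) ∧
        (∀ S ⊆ L, 0 ≤ ∑ j ∈ S, u j))
      ↔ (∀ K ⊆ W,
          ∑ j ∈ K, (Jstar (L.erase j) - Jstar L) ≤ Jstar (L \ K) - Jstar L) := by
  have hnn : ∀ j ∈ L, 0 ≤ u j := by
    intro j hj
    have := hmono (L.erase j) L (Finset.erase_subset j L) hLZ
    rw [hu j hj]; linarith
  constructor
  · rintro ⟨h, -⟩ K hK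
    have hKL : K ⊆ L := by
      intro j hj
      have := hK hj
      rw [hW] at this
      exact (Finset.mem_filter.mp this).1
    have h1 := h (L \ K) Finset.sdiff_subset
    have h2 := Finset.sum_sdiff (f := u) hKL
    have h3 : ∑ j ∈ K, u j = ∑ j ∈ K, (Jstar (L.erase j) - Jstar L) :=
      Finset.sum_congr rfl fun j hj => hu j (hKL hj)
    linarith
  · intro h
    refine ⟨fun S hS => ?_, fun S hS => Finset.sum_nonneg fun j hj => hnn j (hS hj)⟩
    have hsub : (L \ S) ∩ W ⊆ L \ S := Finset.inter_subset_left
    have h1 := h ((L \ S) ∩ W) Finset.inter_subset_right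
    have h2 := Finset.sum_sdiff (f := u) hS
    have h3 : ∑ j ∈ (L \ S) ∩ W, u j
        = ∑ j ∈ (L \ S) ∩ W, (Jstar (L.erase j) - Jstar L) :=
      Finset.sum_congr rfl fun j hj => hu j (Finset.mem_sdiff.mp (hsub hj)).1
    have h4 : ∑ j ∈ (L \ S) ∩ W, u j = ∑ j ∈ L \ S, u j := by
      refine Finset.sum_subset hsub fun j hj hn => ?_
      have hjL := (Finset.mem_sdiff.mp hj).1
      refine le_antisymm (not_lt.mp fun hpos => hn ?_) (hnn j hjL)
      rw [hu j hjL] at hpos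
      rw [hW]
      exact Finset.mem_inter.mpr ⟨hj, Finset.mem_filter.mpr ⟨hjL, hpos⟩⟩
    have h5 := hmono S (L \ ((L \ S) ∩ W)) (fun j hj => Finset.mem_sdiff.mpr
      ⟨hS hj, fun hk => (Finset.mem_sdiff.mp (hsub hk)).2 hj⟩)
      (Finset.sdiff_subset.trans hLZ)
    linarith
end

section
/- Payoff monotonicity characterizes core outcomes (Theorem 2): assume truthful bidding. The VCG outcome of the auction (L,w) lies in the core for every finite subset L ⊆ Z if and only if every participant j ∈ Z displays payoff monotonicity, i.e., for all finite sets S ⊆ S' ⊆ Z with j ∈ S: J*(S'∖{j}) − J*(S') ≤ J*(S∖{j}) − J*(S). -/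
/-!
STATEMENT 4: Payoff monotonicity characterizes core outcomes
(Theorem 2 of Sessa, Walton, Kamgarpour).

`Z` is a finite set of potential participants and `Jstar` gives the auctioneer's
optimal procurement cost for each subset of participants; adding participants
cannot increase the cost.  For each `L ⊆ Z`, truthful bidding and Clarke pivot
payments give utilities `u_j(L) = Jstar (L \ {j}) - Jstar L` for `j ∈ L` and
`u₀(L) = -Jstar L - ∑_{j ∈ L} u_j(L)` for the auctioneer.

The VCG outcome of the auction `(L, w)` lies in the core — every coalition
`S ⊆ L ∪ {0}` is unblocked: `-Jstar S ≤ u₀(L) + ∑_{j ∈ S} u_j(L)` for coalitions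
containing the auctioneer, `0 ≤ ∑_{j ∈ S} u_j(L)` for the others — for every
finite subset `L ⊆ Z`, if and only if every participant `j ∈ Z` displays payoff
monotonicity: for all `S ⊆ S' ⊆ Z` with `j ∈ S`,
`Jstar (S' \ {j}) - Jstar S' ≤ Jstar (S \ {j}) - Jstar S`.
-/

theorem vcg_payoff_monotonicity_iff_core
    {α : Type*} [DecidableEq α] (Z : Finset α)
    (Jstar : Finset α → ℝ)
    (hmono : ∀ S S' : Finset α, S ⊆ S' → S' ⊆ Z → Jstar S' ≤ Jstar S) :
    (∀ L ⊆ Z,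
        (∀ S ⊆ L,
          -Jstar S ≤ (-Jstar L - ∑ j ∈ L, (Jstar (L.erase j) - Jstar L))
            + ∑ j ∈ S, (Jstar (L.erase j) - Jstar L)) ∧
        (∀ S ⊆ L, 0 ≤ ∑ j ∈ S, (Jstar (L.erase j) - Jstar L)))
      ↔ (∀ j ∈ Z, ∀ S S' : Finset α, S ⊆ S' → S' ⊆ Z → j ∈ S →
          Jstar (S'.erase j) - Jstar S' ≤ Jstar (S.erase j) - Jstar S) := by
  constructor
  · intro h j hj S S' hSS' hS'Z hjS
    have key : ∀ T : Finset α, S ∪ T ⊆ Z →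
        Jstar ((S ∪ T).erase j) - Jstar (S ∪ T) ≤ Jstar (S.erase j) - Jstar S := by
      intro T
      induction T using Finset.induction_on with
      | empty => intro _; simp
      | insert a T haT ih =>
        intro hZ
        rw [Finset.union_insert] at hZ ⊢
        have ih' := ih ((Finset.subset_insert _ _).trans hZ)
        by_cases ha : a ∈ S ∪ T
        · rw [Finset.insert_eq_of_mem ha]; exact ih'
        · have hjM : j ∈ S ∪ T := Finset.mem_union_left _ hjS
          generalize S ∪ T = M at *
          have hja : a ≠ j := fun e => ha (e ▸ hjM)
          have h1 := (h _ hZ).1 (M.erase j)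
            ((Finset.erase_subset _ _).trans (Finset.subset_insert _ _))
          rw [Finset.sum_insert ha, ← Finset.add_sum_erase M _ hjM,
            Finset.erase_insert ha] at h1
          linarith
    have := key S' (by rwa [Finset.union_eq_right.2 hSS'])
    rwa [Finset.union_eq_right.2 hSS'] at this
  · intro h L hL
    refine ⟨fun S hS => ?_, fun S hS => Finset.sum_nonneg fun j _ =>
      sub_nonneg.2 (hmono _ _ (Finset.erase_subset _ _) hL)⟩
    have key : ∀ T : Finset α, T ⊆ L →
        ∑ j ∈ T, (Jstar (L.erase j) - Jstar L) ≤ Jstar (L \ T) - Jstar L := by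
      intro T
      induction T using Finset.induction_on with
      | empty => intro _; simp
      | insert a T haT ih =>
        intro hT
        have ih' := ih ((Finset.subset_insert _ _).trans hT)
        have haL := hT (Finset.mem_insert_self a T)
        have h1 := h a (hL haL) (L \ T) L Finset.sdiff_subset hL
          (Finset.mem_sdiff.2 ⟨haL, haT⟩)
        have e : L \ insert a T = (L \ T).erase a := by
          ext x; simp only [Finset.mem_sdiff, Finset.mem_insert, Finset.mem_erase]; tauto
        rw [Finset.sum_insert haT, e]
        linarith
    have h1 := key (L \ S) Finset.sdiff_subset
    rw [Finset.sdiff_sdiff_eq_self hS] at h1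
    have h2 := Finset.sum_sdiff (f := fun j => Jstar (L.erase j) - Jstar L) hS
    linarith
end

section
/- Regularity of optimal allocations under an entering participant (Lemma 2): suppose every participant's cost function c_j is strictly increasing and satisfies condition (i) (strictly increasing marginal cost). Let S ⊆ Z be nonempty, let i ∈ Z∖S, suppose the optimal allocation p for S is unique, and let p' be an optimal allocation for S∪{i}. Then the accepted amount of every incumbent does not increase: p'_j ≤ p_j for every j ∈ S. -/
/-!
STATEMENT 8: Regularity of optimal allocations under an entering participant
(Lemma 2 of Sessa, Walton, Kamgarpour), in the concrete clearing model (4).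

`Z` is a finite set of potential participants; the auctioneer must procure
`M` units of power.  Participant `j` has cost function `c j : ℕ → ℝ` with
`c j 0 = 0`.  An allocation for a nonempty `S ⊆ Z` is `p : α → ℕ` supported on
`S` with `∑_{j ∈ S} p j ≥ M`; its cost is `∑_{j ∈ S} c j (p j)`.

Suppose every participant's cost function is strictly increasing and has
strictly increasing marginal cost (condition (i)).  Let `S ⊆ Z` be nonempty,
`i ∈ Z \ S`, let the optimal allocation `p` for `S` be unique, and let `p'` be
an optimal allocation for `S ∪ {i}`.  Then `p' j ≤ p j` for every `j ∈ S`.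
-/

/-- `p` is a feasible allocation for participants `S` with procurement target `M`. -/
def IsAlloc {α : Type*} [DecidableEq α] (S : Finset α) (M : ℕ) (p : α → ℕ) : Prop :=
  (∀ j ∉ S, p j = 0) ∧ M ≤ ∑ j ∈ S, p j

/-- The cost of allocation `p` for participants `S` under cost functions `c`. -/
def allocCost {α : Type*} (c : α → ℕ → ℝ) (S : Finset α) (p : α → ℕ) : ℝ :=
  ∑ j ∈ S, c j (p j)

/-- Condition (i): strictly increasing marginal cost. -/
def StrictlyIncreasingMarginalCost (b : ℕ → ℝ) : Prop :=
  ∀ k : ℕ, b (k + 1) - b k < b (k + 2) - b (k + 1)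

theorem sum_update_one {α R : Type*} [DecidableEq α] [AddCommMonoid R] (T : Finset α)
    (f : α → ℕ → R) (p : α → ℕ) (a : α) (ha : a ∈ T) (v : ℕ) :
    ∑ x ∈ T, f x (Function.update p a v x) + f a (p a) = ∑ x ∈ T, f x (p x) + f a v := by
  rw [← Finset.add_sum_erase T _ ha, ← Finset.add_sum_erase T (fun x => f x (p x)) ha]
  have : ∑ x ∈ T.erase a, f x (Function.update p a v x) = ∑ x ∈ T.erase a, f x (p x) := by
    apply Finset.sum_congr rfl
    intro x hx
    rw [Function.update_of_ne (Finset.ne_of_mem_erase hx)]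
  rw [this]
  simp only [Function.update_self]
  abel

/-- Move one unit from `a` to `b`. -/
def moveUnit {α : Type*} [DecidableEq α] (p : α → ℕ) (a b : α) : α → ℕ :=
  Function.update (Function.update p a (p a - 1)) b (p b + 1)

theorem moveUnit_alloc {α : Type*} [DecidableEq α] (T : Finset α) (M : ℕ)
    (p : α → ℕ) (a b : α) (ha : a ∈ T) (hb : b ∈ T) (hab : a ≠ b) (hpa : 0 < p a)
    (h : IsAlloc T M p) : IsAlloc T M (moveUnit p a b) := by
  refine ⟨fun j hj => ?_, ?_⟩
  · have h1 : j ≠ a := fun e => hj (e ▸ ha)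
    have h2 : j ≠ b := fun e => hj (e ▸ hb)
    simp [moveUnit, h1, h2, h.1 j hj]
  · have e1 := sum_update_one T (fun _ n => n) p a ha (p a - 1)
    have e2 := sum_update_one T (fun _ n => n) (Function.update p a (p a - 1)) b hb (p b + 1)
    have h2 := h.2
    simp only [Function.update_of_ne hab.symm] at e2
    simp only [moveUnit]
    omega

theorem moveUnit_cost {α : Type*} [DecidableEq α] (c : α → ℕ → ℝ) (T : Finset α)
    (p : α → ℕ) (a b : α) (ha : a ∈ T) (hb : b ∈ T) (hab : a ≠ b) :
    allocCost c T (moveUnit p a b) =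
      allocCost c T p - (c a (p a) - c a (p a - 1)) + (c b (p b + 1) - c b (p b)) := by
  have e1 := sum_update_one T c p a ha (p a - 1)
  have e2 := sum_update_one T c (Function.update p a (p a - 1)) b hb (p b + 1)
  simp only [Function.update_of_ne hab.symm] at e2
  simp only [moveUnit, allocCost]
  linarith

theorem entering_participant_regularity
    {α : Type*} [DecidableEq α] (Z : Finset α) (M : ℕ)
    (c : α → ℕ → ℝ)
    (hc0 : ∀ j, c j 0 = 0)
    (hinc : ∀ j, StrictMono (c j))
    (hmarg : ∀ j, StrictlyIncreasingMarginalCost (c j))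
    (S : Finset α) (hSZ : S ⊆ Z) (hSne : S.Nonempty)
    (i : α) (hiZ : i ∈ Z) (hiS : i ∉ S)
    (p p' : α → ℕ)
    (hp : IsAlloc S M p)
    (hpopt : ∀ q : α → ℕ, IsAlloc S M q → allocCost c S p ≤ allocCost c S q)
    (hpuniq : ∀ q : α → ℕ, IsAlloc S M q →
      (∀ r : α → ℕ, IsAlloc S M r → allocCost c S q ≤ allocCost c S r) → q = p)
    (hp' : IsAlloc (insert i S) M p')
    (hp'opt : ∀ q : α → ℕ, IsAlloc (insert i S) M q →
      allocCost c (insert i S) p' ≤ allocCost c (insert i S) q) :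
    ∀ j ∈ S, p' j ≤ p j := by
  intro j hj
  by_contra! hlt
  have hjT : j ∈ insert i S := Finset.mem_insert_of_mem hj
  have hmono : ∀ x, Monotone fun n => c x (n + 1) - c x n := fun x =>
    monotone_nat_of_le_succ fun n => (hmarg x n).le
  have htot : ∑ x ∈ insert i S, p' x ≤ M := by
    by_contra! hM
    have e1 := sum_update_one (insert i S) (fun _ n => n) p' j hjT (p' j - 1)
    have e2 := sum_update_one (insert i S) c p' j hjT (p' j - 1)
    have h3 := hp'opt (Function.update p' j (p' j - 1)) ⟨fun x hx => by
      have : x ≠ j := fun e => hx (e ▸ hjT)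
      rw [Function.update_of_ne this, hp'.1 x hx], by omega⟩
    have h4 : c j (p' j - 1) < c j (p' j) := hinc j (by omega)
    simp only [allocCost] at h3
    linarith
  rw [Finset.sum_insert hiS] at htot
  have hk : ∃ k ∈ S, p' k < p k := by
    by_contra! hall
    have := Finset.sum_lt_sum hall ⟨j, hj, hlt⟩
    have := hp.2
    omega
  obtain ⟨k, hk, hklt⟩ := hk
  have hkj : k ≠ j := by rintro rfl; omega
  have hkT : k ∈ insert i S := Finset.mem_insert_of_mem hk
  have A := hp'opt _ (moveUnit_alloc _ M p' j k hjT hkT hkj.symm (by omega) hp')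
  rw [moveUnit_cost c _ p' j k hjT hkT hkj.symm] at A
  have hq := moveUnit_alloc S M p k j hk hj hkj (by omega) hp
  have B : allocCost c S p < allocCost c S (moveUnit p k j) := by
    by_contra! hle
    have := congrFun (hpuniq _ hq fun r hr => hle.trans (hpopt r hr)) j
    simp [moveUnit] at this
  rw [moveUnit_cost c _ p k j hk hj hkj] at B
  have C := hmono j (show p j ≤ p' j - 1 by omega)
  have D := hmono k (show p' k ≤ p k - 1 by omega)
  simp only [Nat.sub_add_cancel (show 1 ≤ p' j by omega)] at C
  simp only [Nat.sub_add_cancel (show 1 ≤ p k by omega)] at D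
  linarith
end

section
/- A loser cannot become a winner as more participants enter: suppose every participant's cost function c_j is strictly increasing and satisfies condition (i). Let j ∈ S ⊆ Z with S∖{j} nonempty, and suppose J*(S∖{j}) = J*(S) (j is a loser of the auction with participants S). Then for every i ∈ Z∖S, J*((S∪{i})∖{j}) = J*(S∪{i}), so j is still a loser after i enters. -/
theorem marg_mono_aux (b : ℕ → ℝ) (h : StrictlyIncreasingMarginalCost b) :
    Monotone (fun k => b (k + 1) - b k) :=
  monotone_nat_of_le_succ (fun k => (h k).le)

theorem key_aux {α : Type*} [DecidableEq α] (M : ℕ) (c : α → ℕ → ℝ)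
    (hc0 : ∀ j, c j 0 = 0)
    (hinc : ∀ j, StrictMono (c j))
    (hmarg : ∀ j, StrictlyIncreasingMarginalCost (c j))
    (U T : Finset α) (hTU : T ⊆ U) (j : α) (q : α → ℕ) (hq : M ≤ ∑ k ∈ T, q k)
    (hmq : ∀ k ∈ T, ∀ a, q k = a + 1 → c k (a + 1) - c k a ≤ c j 1) :
    ∀ (n : ℕ) (p : α → ℕ), M ≤ n + ∑ k ∈ U, p k →
      ∃ p' : α → ℕ, M ≤ ∑ k ∈ U, p' k ∧
        ∑ k ∈ U, c k (p' k) ≤ c j n + ∑ k ∈ U, c k (p k) := by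
  intro n
  induction n with
  | zero =>
    intro p hp
    exact ⟨p, by simpa using hp, by simp [hc0]⟩
  | succ n ih =>
    intro p hp
    by_cases hex : ∃ k ∈ T, p k < q k
    · obtain ⟨k, hkT, hk⟩ := hex
      have hkU := hTU hkT
      have h1 : ∑ x ∈ U, Function.update p k (p k + 1) x = ∑ x ∈ U, p x + 1 := by
        rw [← Finset.add_sum_erase _ _ hkU, ← Finset.add_sum_erase U p hkU,
          Finset.sum_congr rfl (g := p)]
        · simp; ring
        · intro x hx
          simp [Finset.ne_of_mem_erase hx]
      have h2 : ∑ x ∈ U, c x (Function.update p k (p k + 1) x)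
          = ∑ x ∈ U, c x (p x) + (c k (p k + 1) - c k (p k)) := by
        rw [← Finset.add_sum_erase _ _ hkU, ← Finset.add_sum_erase U (fun x => c x (p x)) hkU,
          Finset.sum_congr rfl (g := fun x => c x (p x))]
        · simp; ring
        · intro x hx
          simp [Finset.ne_of_mem_erase hx]
      obtain ⟨p', hp', hc⟩ := ih (Function.update p k (p k + 1)) (by rw [h1]; omega)
      refine ⟨p', hp', hc.trans ?_⟩
      rw [h2]
      obtain ⟨a, ha⟩ : ∃ a, q k = a + 1 := ⟨q k - 1, by omega⟩
      have h3 := hmq k hkT a ha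
      have h4 : c k (p k + 1) - c k (p k) ≤ c k (a + 1) - c k a :=
        marg_mono_aux _ (hmarg k) (show p k ≤ a by omega)
      have h5 : c j (0 + 1) - c j 0 ≤ c j (n + 1) - c j n :=
        marg_mono_aux _ (hmarg j) (Nat.zero_le n)
      rw [hc0, zero_add] at h5
      linarith
    · push Not at hex
      refine ⟨p, hq.trans ((Finset.sum_le_sum hex).trans
        (Finset.sum_le_sum_of_subset hTU)), ?_⟩
      have := (hinc j).monotone (Nat.zero_le (n + 1))
      rw [hc0] at this
      linarith

theorem loser_stays_loser
    {α : Type*} [DecidableEq α] (Z : Finset α) (M : ℕ)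
    (c : α → ℕ → ℝ)
    (hc0 : ∀ j, c j 0 = 0)
    (hinc : ∀ j, StrictMono (c j))
    (hmarg : ∀ j, StrictlyIncreasingMarginalCost (c j))
    (Jstar : Finset α → ℝ)
    (hJstar : ∀ T : Finset α, T ⊆ Z → T.Nonempty →
      IsLeast {r : ℝ | ∃ p : α → ℕ, IsAlloc T M p ∧ r = allocCost c T p} (Jstar T))
    (S : Finset α) (hSZ : S ⊆ Z) (j : α) (hjS : j ∈ S)
    (hSj : (S.erase j).Nonempty)
    (hloser : Jstar (S.erase j) = Jstar S)
    (i : α) (hiZ : i ∈ Z) (hiS : i ∉ S) :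
    Jstar ((insert i S).erase j) = Jstar (insert i S) := by
  have hji : j ≠ i := fun h => hiS (h ▸ hjS)
  have hZ : insert i S ⊆ Z := Finset.insert_subset hiZ hSZ
  have hjI : j ∈ insert i S := Finset.mem_insert_of_mem hjS
  have hTU : S.erase j ⊆ (insert i S).erase j :=
    Finset.erase_subset_erase _ (Finset.subset_insert _ _)
  obtain ⟨⟨q, ⟨hq0, hqM⟩, hqc⟩, -⟩ := hJstar (S.erase j) ((Finset.erase_subset _ _).trans hSZ) hSj
  have hS := (hJstar S hSZ ⟨j, hjS⟩).2
  obtain ⟨⟨p, ⟨hp0, hpM⟩, hpc⟩, hIlb⟩ := hJstar (insert i S) hZ ⟨j, hjI⟩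
  obtain ⟨⟨r, ⟨hr0, hrM⟩, hrc⟩, hUlb⟩ := hJstar ((insert i S).erase j)
    ((Finset.erase_subset _ _).trans hZ) (hSj.mono hTU)
  unfold allocCost at *
  have hmq : ∀ k ∈ S.erase j, ∀ a, q k = a + 1 → c k (a + 1) - c k a ≤ c j 1 := by
    intro k hk a ha
    have hkj := Finset.ne_of_mem_erase hk
    have hkS := Finset.mem_of_mem_erase hk
    set w := Function.update (Function.update q k a) j 1 with hw
    have hwj : w j = 1 := by simp [hw]
    have hwk : w k = a := by simp [hw, hkj]
    have hwx : ∀ x ∈ (S.erase j).erase k, w x = q x := by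
      intro x hx
      simp only [Finset.mem_erase] at hx
      simp [hw, hx.1, hx.2.1]
    have e1 : ∑ x ∈ S, w x = 1 + (a + ∑ x ∈ (S.erase j).erase k, q x) := by
      rw [← Finset.add_sum_erase S _ hjS, ← Finset.add_sum_erase (S.erase j) _ hk, hwj, hwk,
        Finset.sum_congr rfl hwx]
    have e2 : ∑ x ∈ S, c x (w x)
        = c j 1 + (c k a + ∑ x ∈ (S.erase j).erase k, c x (q x)) := by
      rw [← Finset.add_sum_erase S _ hjS, ← Finset.add_sum_erase (S.erase j) _ hk, hwj, hwk,
        Finset.sum_congr rfl (fun x hx => by rw [hwx x hx])]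
    rw [← Finset.add_sum_erase (S.erase j) _ hk, ha] at hqM hqc
    have := hS ⟨w, ⟨?_, by rw [e1]; omega⟩, rfl⟩
    · rw [e2, ← hloser, hqc] at this
      linarith
    · intro x hx
      have hxj : x ≠ j := fun h => hx (h ▸ hjS)
      have hxk : x ≠ k := fun h => hx (h ▸ hkS)
      simp only [hw, Function.update_of_ne hxj, Function.update_of_ne hxk]
      exact hq0 x (fun h => hx (Finset.mem_of_mem_erase h))
  rw [← Finset.add_sum_erase _ _ hjI] at hpM hpc
  obtain ⟨p', hp', hpc'⟩ := key_aux M c hc0 hinc hmarg _ _ hTU j q hqM hmq (p j) p hpM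
  apply le_antisymm
  · rw [hpc]
    refine le_trans (hUlb ⟨fun x => if x ∈ (insert i S).erase j then p' x else 0,
      ⟨fun x hx => if_neg hx, ?_⟩, rfl⟩) (le_trans (le_of_eq ?_) hpc')
    · exact hp'.trans (le_of_eq (Finset.sum_congr rfl (fun x hx => (if_pos hx).symm)))
    · exact Finset.sum_congr rfl (fun x hx => congrArg (c x) (if_pos hx))
  · have hrj : r j = 0 := hr0 j (Finset.notMem_erase _ _)
    rw [hrc]
    refine hIlb ⟨r, ⟨fun x hx => hr0 x (fun h => hx (Finset.mem_of_mem_erase h)), ?_⟩, ?_⟩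
    · rw [← Finset.add_sum_erase _ _ hjI]; omega
    · rw [← Finset.add_sum_erase _ (fun x => c x (r x)) hjI, hrj, hc0, zero_add]
end

section
/- Monotonicity of optimal allocations in the procurement target: suppose every participant's cost function c_j is strictly increasing and satisfies condition (i). Fix a nonempty S ⊆ Z and targets M̄₁ ≤ M̄₂, and suppose the optimal allocations q for target M̄₁ and p for target M̄₂ (both over participants S) are unique. Then q_j ≤ p_j for every j ∈ S: when a lower amount of power is to be procured, the amount accepted from each participant never increases. -/
theorem sum_upd_aux {α A : Type*} [DecidableEq α] [AddCommMonoid A] (f : α → ℕ → A)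
    (S : Finset α) (r : α → ℕ) (j : α) (hj : j ∈ S) (a : ℕ) :
    ∑ i ∈ S, f i (Function.update r j a i) + f j (r j) = ∑ i ∈ S, f i (r i) + f j a := by
  rw [← Finset.add_sum_erase S _ hj, ← Finset.add_sum_erase S (fun i => f i (r i)) hj]
  have h : ∑ i ∈ S.erase j, f i (Function.update r j a i) = ∑ i ∈ S.erase j, f i (r i) := by
    refine Finset.sum_congr rfl fun i hi => ?_
    rw [Function.update_of_ne (Finset.ne_of_mem_erase hi)]
  rw [h, Function.update_self]
  simp only [add_comm, add_left_comm]

theorem sum_upd2_aux {α A : Type*} [DecidableEq α] [AddCommMonoid A] (f : α → ℕ → A)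
    (S : Finset α) (r : α → ℕ) (j k : α) (hj : j ∈ S) (hk : k ∈ S) (hjk : k ≠ j) (a b : ℕ) :
    ∑ i ∈ S, f i (Function.update (Function.update r j a) k b i) + f k (r k) + f j (r j)
      = ∑ i ∈ S, f i (r i) + f j a + f k b := by
  have h1 := sum_upd_aux f S (Function.update r j a) k hk b
  have h2 := sum_upd_aux f S r j hj a
  rw [Function.update_of_ne hjk] at h1
  rw [h1, add_right_comm, h2]

theorem marg_mono_aux_s10 {b : ℕ → ℝ} (h : StrictlyIncreasingMarginalCost b) {m n : ℕ} (hmn : m ≤ n) :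
    b (m + 1) - b m ≤ b (n + 1) - b n :=
  monotone_nat_of_le_succ (f := fun k => b (k + 1) - b k) (fun k => (h k).le) hmn

theorem optimal_allocation_monotone_in_target
    {α : Type*} [DecidableEq α] (Z : Finset α)
    (c : α → ℕ → ℝ)
    (hc0 : ∀ j, c j 0 = 0)
    (hinc : ∀ j, StrictMono (c j))
    (hmarg : ∀ j, StrictlyIncreasingMarginalCost (c j))
    (S : Finset α) (hSZ : S ⊆ Z) (hSne : S.Nonempty)
    (M₁ M₂ : ℕ) (hM : M₁ ≤ M₂)
    (q p : α → ℕ)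
    (hq : IsAlloc S M₁ q)
    (hqopt : ∀ r : α → ℕ, IsAlloc S M₁ r → allocCost c S q ≤ allocCost c S r)
    (hquniq : ∀ r : α → ℕ, IsAlloc S M₁ r →
      (∀ r' : α → ℕ, IsAlloc S M₁ r' → allocCost c S r ≤ allocCost c S r') → r = q)
    (hp : IsAlloc S M₂ p)
    (hpopt : ∀ r : α → ℕ, IsAlloc S M₂ r → allocCost c S p ≤ allocCost c S r)
    (hpuniq : ∀ r : α → ℕ, IsAlloc S M₂ r →
      (∀ r' : α → ℕ, IsAlloc S M₂ r' → allocCost c S r ≤ allocCost c S r') → r = p) :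
    ∀ j ∈ S, q j ≤ p j := by
  intro j hj
  by_contra! hlt
  obtain ⟨a, ha⟩ : ∃ a, q j = a + 1 := ⟨q j - 1, by omega⟩
  have hsum : ∑ i ∈ S, q i ≤ M₁ := by
    by_contra! hgt
    have h1 := sum_upd_aux (fun _ n => n) S q j hj a
    have h2 := sum_upd_aux c S q j hj a
    have h3 := hqopt (Function.update q j a) ⟨fun i hi => by
      rw [Function.update_of_ne (by rintro rfl; exact hi hj)]; exact hq.1 i hi, by
      omega⟩
    have h4 := hinc j (Nat.lt_succ_self a)
    unfold allocCost at h3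
    rw [ha] at h2
    simp only [Nat.succ_eq_add_one] at h4
    linarith
  obtain ⟨k, hk, hkl⟩ : ∃ k ∈ S, q k < p k := by
    by_contra! hall
    have := Finset.sum_lt_sum hall ⟨j, hj, hlt⟩
    have := hp.2
    omega
  have hjk : k ≠ j := by rintro rfl; omega
  obtain ⟨b, hb⟩ : ∃ b, p k = b + 1 := ⟨p k - 1, by omega⟩
  have feas : ∀ (M : ℕ) (r : α → ℕ) (x y : ℕ), IsAlloc S M r → x + y = r j + r k →
      IsAlloc S M (Function.update (Function.update r j x) k y) := by
    intro M r x y hr hxy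
    refine ⟨fun i hi => ?_, ?_⟩
    · rw [Function.update_of_ne (by rintro rfl; exact hi hk),
        Function.update_of_ne (by rintro rfl; exact hi hj)]
      exact hr.1 i hi
    · have h1 := sum_upd2_aux (fun _ n => n) S r j k hj hk hjk x y
      have := hr.2
      omega
  have fq := feas M₁ q a (q k + 1) hq (by omega)
  have cq := sum_upd2_aux c S q j k hj hk hjk a (q k + 1)
  have cp := sum_upd2_aux c S p j k hj hk hjk (p j + 1) b
  have op := hpopt _ (feas M₂ p (p j + 1) b hp (by omega))
  have m1 := marg_mono_aux_s10 (hmarg j) (show p j ≤ a by omega)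
  have m2 := marg_mono_aux_s10 (hmarg k) (show q k ≤ b by omega)
  rw [ha] at cq
  rw [hb] at cp
  have key : allocCost c S (Function.update (Function.update q j a) k (q k + 1))
      ≤ allocCost c S q := by
    unfold allocCost at op ⊢
    linarith
  have e := hquniq _ fq fun r' hr' => key.trans (hqopt r' hr')
  have := congrFun e k
  rw [Function.update_self] at this
  omega
end

section
/- Condition (i) implies payoff monotonicity (Theorem 3): suppose every participant's cost function c_j is strictly increasing and satisfies condition (i) (strictly increasing marginal cost). Then every participant displays payoff monotonicity under the VCG payment rule: for every j and all finite sets S ⊆ S' ⊆ Z with j ∈ S and S∖{j} nonempty, J*(S'∖{j}) − J*(S') ≤ J*(S∖{j}) − J*(S). -/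
theorem marg_mono_aux_s11 {f : ℕ → ℝ} (h : StrictlyIncreasingMarginalCost f) (x y d : ℕ)
    (hxy : x ≤ y) : f (x + d) - f x ≤ f (y + d) - f y := by
  have hm : Monotone fun k => f (k + 1) - f k :=
    monotone_nat_of_le_succ fun k => (h k).le
  induction d with
  | zero => simp
  | succ d ih =>
    have h1 := hm (show x + d ≤ y + d by omega)
    simp only [← add_assoc] at *
    linarith

theorem exchange_aux {f : ℕ → ℝ} (h : StrictlyIncreasingMarginalCost f) (p q b : ℕ)
    (h1 : q ≤ b) (h2 : b ≤ max p q) : f (p + q - b) + f b ≤ f p + f q := by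
  rcases le_total p q with hpq | hpq
  · have : b = q := by rw [max_eq_right hpq] at h2; omega
    subst this
    simp
  · rw [max_eq_left hpq] at h2
    have := marg_mono_aux_s11 h q (p + q - b) (b - q) (by omega)
    rw [show q + (b - q) = b by omega, show p + q - b + (b - q) = p by omega] at this
    linarith

theorem interp_aux {α : Type*} [DecidableEq α] (T : Finset α) (q m : α → ℕ)
    (hqm : ∀ i, q i ≤ m i) (n : ℕ) (hn : ∑ i ∈ T, q i ≤ n) :
    n ≤ ∑ i ∈ T, m i → ∃ b : α → ℕ, (∀ i, q i ≤ b i ∧ b i ≤ m i) ∧ ∑ i ∈ T, b i = n := by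
  induction n, hn using Nat.le_induction with
  | base => exact fun _ => ⟨q, fun i => ⟨le_rfl, hqm i⟩, rfl⟩
  | succ n hn ih =>
    intro hle
    obtain ⟨b, hb, hs⟩ := ih (by omega)
    obtain ⟨i, hi, hlt⟩ : ∃ i ∈ T, b i < m i :=
      Finset.exists_lt_of_sum_lt (by omega)
    refine ⟨Function.update b i (b i + 1), fun k => ?_, ?_⟩
    · by_cases hk : k = i
      · subst hk
        have := hb k
        simp only [Function.update_self]
        omega
      · simpa [Function.update_of_ne hk] using hb k
    · rw [Finset.sum_update_of_mem hi]
      have := Finset.sum_sdiff (f := b) (Finset.singleton_subset_iff.2 hi)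
      rw [Finset.sum_singleton] at this
      omega

theorem condition_i_implies_payoff_monotonicity
    {α : Type*} [DecidableEq α] (Z : Finset α) (M : ℕ)
    (c : α → ℕ → ℝ)
    (hc0 : ∀ j, c j 0 = 0)
    (hinc : ∀ j, StrictMono (c j))
    (hmarg : ∀ j, StrictlyIncreasingMarginalCost (c j))
    (Jstar : Finset α → ℝ)
    (hJstar : ∀ T : Finset α, T ⊆ Z → T.Nonempty →
      IsLeast {r : ℝ | ∃ p : α → ℕ, IsAlloc T M p ∧ r = allocCost c T p} (Jstar T))
    (j : α) (S S' : Finset α)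
    (hSS' : S ⊆ S') (hS'Z : S' ⊆ Z) (hjS : j ∈ S)
    (hSj : (S.erase j).Nonempty) :
    Jstar (S'.erase j) - Jstar S' ≤ Jstar (S.erase j) - Jstar S := by
  obtain ⟨T, hT⟩ : ∃ T, T = S.erase j := ⟨_, rfl⟩
  obtain ⟨W, hW⟩ : ∃ W, W = S'.erase j := ⟨_, rfl⟩
  have hTW : T ⊆ W := by rw [hT, hW]; exact Finset.erase_subset_erase j hSS'
  have hjT : j ∉ T := by simp [hT]
  have hjW : j ∉ W := by simp [hW]
  have hS : S = insert j T := by rw [hT, Finset.insert_erase hjS]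
  have hS' : S' = insert j W := by rw [hW, Finset.insert_erase (hSS' hjS)]
  rw [← hT] at hSj ⊢
  rw [← hW]
  have hWZ : W ⊆ Z := by rw [hW]; exact (Finset.erase_subset _ _).trans hS'Z
  obtain ⟨⟨p, ⟨-, hpM⟩, hpc⟩, -⟩ := hJstar T (hTW.trans hWZ) hSj
  obtain ⟨⟨q, ⟨-, hqM⟩, hqc⟩, -⟩ := hJstar S' hS'Z ⟨j, hSS' hjS⟩
  have hJW := (hJstar W hWZ (hSj.mono hTW)).2
  have hJS := (hJstar S (hSS'.trans hS'Z) ⟨j, hjS⟩).2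
  rw [hS', Finset.sum_insert hjW, ← Finset.sum_sdiff hTW] at hqM
  unfold allocCost at *
  rw [hS', Finset.sum_insert hjW, ← Finset.sum_sdiff hTW, ← hS'] at hqc
  have hmax : ∑ i ∈ T, p i ≤ ∑ i ∈ T, max (p i) (q i) :=
    Finset.sum_le_sum fun i _ => le_max_left _ _
  have hmax' : ∑ i ∈ T, q i ≤ ∑ i ∈ T, max (p i) (q i) :=
    Finset.sum_le_sum fun i _ => le_max_right _ _
  obtain ⟨b, hb, hbs⟩ := interp_aux T q (fun i => max (p i) (q i)) (fun i => le_max_right _ _)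
    (max (∑ i ∈ T, q i) (M - q j)) (le_max_left _ _) (by omega)
  have hab : ∑ i ∈ T, (p i + q i - b i) + ∑ i ∈ T, b i = ∑ i ∈ T, p i + ∑ i ∈ T, q i := by
    rw [← Finset.sum_add_distrib, ← Finset.sum_add_distrib]
    refine Finset.sum_congr rfl fun i _ => ?_
    have := hb i
    omega
  have hcost : ∑ i ∈ T, c i (p i + q i - b i) + ∑ i ∈ T, c i (b i)
      ≤ ∑ i ∈ T, c i (p i) + ∑ i ∈ T, c i (q i) := by
    rw [← Finset.sum_add_distrib, ← Finset.sum_add_distrib]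
    exact Finset.sum_le_sum fun i _ => exchange_aux (hmarg i) _ _ _ (hb i).1 (hb i).2
  -- the two new allocations
  obtain ⟨p', hp'⟩ : ∃ p' : α → ℕ, p' = fun i =>
    if i ∈ T then p i + q i - b i else if i ∈ W then q i else 0 := ⟨_, rfl⟩
  obtain ⟨q', hq'⟩ : ∃ q' : α → ℕ, q' = fun i =>
    if i ∈ T then b i else if i = j then q i else 0 := ⟨_, rfl⟩
  have p1 : ∀ i ∈ T, p' i = p i + q i - b i := fun i hi => by simp [hp', hi]
  have p2 : ∀ i ∈ W \ T, p' i = q i := fun i hi => by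
    rw [Finset.mem_sdiff] at hi
    simp [hp', hi.1, hi.2]
  have q1 : ∀ i ∈ T, q' i = b i := fun i hi => by simp [hq', hi]
  have q2 : q' j = q j := by simp [hq', hjT]
  have sp1 : ∑ i ∈ T, p' i = ∑ i ∈ T, (p i + q i - b i) := Finset.sum_congr rfl p1
  have sp2 : ∑ i ∈ W \ T, p' i = ∑ i ∈ W \ T, q i := Finset.sum_congr rfl p2
  have sq1 : ∑ i ∈ T, q' i = ∑ i ∈ T, b i := Finset.sum_congr rfl q1
  have cp1 : ∑ i ∈ T, c i (p' i) = ∑ i ∈ T, c i (p i + q i - b i) :=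
    Finset.sum_congr rfl fun i hi => by rw [p1 i hi]
  have cp2 : ∑ i ∈ W \ T, c i (p' i) = ∑ i ∈ W \ T, c i (q i) :=
    Finset.sum_congr rfl fun i hi => by rw [p2 i hi]
  have h1 := hJW ⟨p', ⟨fun i hi => by
      have : i ∉ T := fun h => hi (hTW h)
      simp [hp', hi, this], by
      rw [← Finset.sum_sdiff hTW, sp1, sp2]
      omega⟩, rfl⟩
  have h2 := hJS ⟨q', ⟨fun i hi => by
      rw [hS, Finset.mem_insert, not_or] at hi
      simp [hq', hi.1, hi.2], by
      rw [hS, Finset.sum_insert hjT, sq1, q2]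
      omega⟩, rfl⟩
  rw [← Finset.sum_sdiff hTW, cp1, cp2] at h1
  have e : ∑ i ∈ S, c i (q' i) = c j (q j) + ∑ i ∈ T, c i (b i) := by
    rw [hS, Finset.sum_insert hjT, q2]
    congr 1
    exact Finset.sum_congr rfl fun i hi => by rw [q1 i hi]
  rw [e] at h2
  linarith
end

section
/- Core outcomes under condition (i) (corollary of Theorems 2 and 3): suppose every participant's cost function c_j is strictly increasing and satisfies condition (i). Then for every finite set of participants L ⊆ Z and every subset K ⊆ L with L∖K nonempty and with L∖{j} nonempty for every j ∈ K, the core inequality holds: Σ_{j∈K} (J*(L∖{j}) − J*(L)) ≤ J*(L∖K) − J*(L). Consequently the VCG outcome with Clarke pivot payments and truthful bidding lies in the core for every such L. -/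
namespace CoreAux

lemma sum_upd {α A : Type*} [DecidableEq α] [AddCommMonoid A] (T : Finset α) (g : α → ℕ → A)
    (p : α → ℕ) (i : α) (hi : i ∈ T) (a : ℕ) :
    ∑ j ∈ T, g j (Function.update p i a j) + g i (p i) = ∑ j ∈ T, g j (p j) + g i a := by
  rw [← Finset.add_sum_erase T _ hi, ← Finset.add_sum_erase T (fun j => g j (p j)) hi]
  have : ∑ j ∈ T.erase i, g j (Function.update p i a j) = ∑ j ∈ T.erase i, g j (p j) := by
    apply Finset.sum_congr rfl
    intro j hj
    rw [Function.update_of_ne (Finset.ne_of_mem_erase hj)]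
  rw [this, Function.update_self]
  abel

lemma sum_upd2 {α A : Type*} [DecidableEq α] [AddCommMonoid A] (T : Finset α) (g : α → ℕ → A)
    (p : α → ℕ) (i k : α) (hi : i ∈ T) (hk : k ∈ T) (hik : k ≠ i) (a b : ℕ) :
    ∑ j ∈ T, g j (Function.update (Function.update p i a) k b j) + g k (p k) + g i (p i)
      = ∑ j ∈ T, g j (p j) + g i a + g k b := by
  have h1 := sum_upd T g (Function.update p i a) k hk b
  have h2 := sum_upd T g p i hi a
  rw [Function.update_of_ne hik] at h1
  rw [h1, add_right_comm, h2]

lemma marg_mono {f : ℕ → ℝ} (hf : StrictlyIncreasingMarginalCost f) :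
    Monotone (fun k => f (k + 1) - f k) :=
  monotone_nat_of_le_succ fun k => (hf k).le

lemma superadd {f : ℕ → ℝ} (hf : StrictlyIncreasingMarginalCost f) (a x y : ℕ) :
    f (a + y) - f a ≤ f (a + x + y) - f (a + x) := by
  induction y with
  | zero => simp
  | succ y ih =>
    have := marg_mono hf (show a + y ≤ a + x + y by omega)
    simp only [← add_assoc] at *
    linarith

lemma superadd_sum {β : Type*} [DecidableEq β] {f : ℕ → ℝ}
    (hf : StrictlyIncreasingMarginalCost f) (a : ℕ)
    (K : Finset β) (d : β → ℕ) :
    ∑ j ∈ K, (f (a + d j) - f a) ≤ f (a + ∑ j ∈ K, d j) - f a := by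
  induction K using Finset.induction_on with
  | empty => simp
  | insert j K hj ih =>
    rw [Finset.sum_insert hj, Finset.sum_insert hj]
    have := superadd hf a (d j) (∑ j ∈ K, d j)
    rw [← add_assoc]
    linarith

lemma exists_sub {α : Type*} [DecidableEq α] (I : Finset α) (D : α → ℕ) (n : ℕ)
    (h : n ≤ ∑ i ∈ I, D i) : ∃ e : α → ℕ, (∀ i, e i ≤ D i) ∧ ∑ i ∈ I, e i = n := by
  induction n with
  | zero => exact ⟨fun _ => 0, by simp, by simp⟩
  | succ n ih =>
    obtain ⟨e, he, hs⟩ := ih (by omega)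
    obtain ⟨i, hi, hlt⟩ := Finset.exists_lt_of_sum_lt (s := I) (f := e) (g := D) (by omega)
    refine ⟨Function.update e i (e i + 1), fun j => ?_, ?_⟩
    · by_cases hj : j = i
      · subst hj; simpa using hlt
      · rw [Function.update_of_ne hj]; exact he j
    · have := sum_upd I (fun _ x => x) e i hi (e i + 1)
      try simp only at this
      omega

lemma exists_split {α : Type*} [DecidableEq α] (I K : Finset α) (r : α → ℕ) :
    ∀ D : α → ℕ, ∑ j ∈ K, r j ≤ ∑ i ∈ I, D i →
    ∃ d : α → α → ℕ, (∀ j ∈ K, ∑ i ∈ I, d j i = r j) ∧ ∀ i, ∑ j ∈ K, d j i ≤ D i := by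
  induction K using Finset.induction_on with
  | empty => intro D _; exact ⟨fun _ _ => 0, by simp, by simp⟩
  | insert k K hk ih =>
    intro D h
    rw [Finset.sum_insert hk] at h
    obtain ⟨e, he, hs⟩ := exists_sub I D (r k) (by omega)
    have h2 : ∑ i ∈ I, (D i - e i) + ∑ i ∈ I, e i = ∑ i ∈ I, D i := by
      rw [← Finset.sum_add_distrib]
      exact Finset.sum_congr rfl fun i _ => Nat.sub_add_cancel (he i)
    obtain ⟨d, hd1, hd2⟩ := ih (fun i => D i - e i) (by omega)
    refine ⟨Function.update d k e, fun j hj => ?_, fun i => ?_⟩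
    · by_cases hjk : j = k
      · subst hjk; simpa using hs
      · rw [Function.update_of_ne hjk]
        exact hd1 j (Finset.mem_of_mem_insert_of_ne hj hjk)
    · rw [Finset.sum_insert hk, Function.update_self]
      have : ∑ j ∈ K, Function.update d k e j i = ∑ j ∈ K, d j i :=
        Finset.sum_congr rfl fun j hj => by
          rw [Function.update_of_ne (ne_of_mem_of_not_mem hj hk)]
      rw [this]
      have := hd2 i
      have := he i
      try simp only at *
      omega

lemma least_le {α : Type*} [DecidableEq α] {c : α → ℕ → ℝ} {T : Finset α} {M : ℕ} {J : ℝ}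
    (h : IsLeast {r : ℝ | ∃ p : α → ℕ, IsAlloc T M p ∧ r = allocCost c T p} J)
    (p : α → ℕ) (hp : M ≤ ∑ j ∈ T, p j) : J ≤ ∑ j ∈ T, c j (p j) := by
  apply h.2
  refine ⟨fun j => if j ∈ T then p j else 0, ⟨fun j hj => by simp [hj], ?_⟩, ?_⟩
  · refine hp.trans (Finset.sum_congr rfl fun j hj => by simp [hj]).le
  · exact Finset.sum_congr rfl fun j hj => by simp [hj]

/-- an optimal `q` on `S ⊆ L` dominating `p` -/
lemma exists_dom {α : Type*} [DecidableEq α] (c : α → ℕ → ℝ)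
    (hmarg : ∀ j, StrictlyIncreasingMarginalCost (c j)) (S : Finset α) (M : ℕ) (p : α → ℕ)
    (hpS : ∑ j ∈ S, p j ≤ M)
    (hex : ∀ i ∈ S, ∀ k ∈ S, k ≠ i → ∀ x, p i = x + 1 →
      c i (x + 1) - c i x ≤ c k (p k + 1) - c k (p k)) (n : ℕ) :
    ∀ q : α → ℕ, M ≤ ∑ j ∈ S, q j → ∑ j ∈ S, (p j - q j) = n →
    ∃ q' : α → ℕ, M ≤ ∑ j ∈ S, q' j ∧ (∀ j ∈ S, p j ≤ q' j) ∧
      ∑ j ∈ S, c j (q' j) ≤ ∑ j ∈ S, c j (q j) := by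
  induction n with
  | zero =>
    intro q hq h0
    refine ⟨q, hq, fun j hj => ?_, le_rfl⟩
    have := (Finset.sum_eq_zero_iff.1 h0) j hj
    omega
  | succ n ih =>
    intro q hq hn
    obtain ⟨i, hi, hlt⟩ : ∃ i ∈ S, q i < p i := by
      by_contra! hcon
      have : ∑ j ∈ S, (p j - q j) = 0 := Finset.sum_eq_zero fun j hj => by
        have := hcon j hj; omega
      omega
    obtain ⟨k, hk, hkl⟩ : ∃ k ∈ S, p k < q k := by
      by_contra! hcon
      have := Finset.sum_lt_sum hcon ⟨i, hi, hlt⟩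
      omega
    have hki : k ≠ i := by rintro rfl; omega
    obtain ⟨x, hx⟩ : ∃ x, p i = x + 1 := ⟨p i - 1, by omega⟩
    obtain ⟨y, hy⟩ : ∃ y, q k = y + 1 := ⟨q k - 1, by omega⟩
    have e1 := sum_upd2 S (fun _ z => z) q i k hi hk hki (q i + 1) y
    have e2 := sum_upd2 S (fun j z => p j - z) q i k hi hk hki (q i + 1) y
    have e3 := sum_upd2 S c q i k hi hk hki (q i + 1) y
    try simp only at e1 e2
    obtain ⟨q', h1, h2, h3⟩ := ih (Function.update (Function.update q i (q i + 1)) k y)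
      (by omega) (by omega)
    refine ⟨q', h1, h2, h3.trans ?_⟩
    have m0 := hex i hi k hk hki x hx
    have m1 := marg_mono (hmarg i) (show q i ≤ x by omega)
    have m2 := marg_mono (hmarg k) (show p k ≤ y by omega)
    try simp only at m1 m2
    rw [hy] at e3
    linarith

end CoreAux

theorem condition_i_implies_core_outcome
    {α : Type*} [DecidableEq α] (Z : Finset α) (M : ℕ)
    (c : α → ℕ → ℝ)
    (hc0 : ∀ j, c j 0 = 0)
    (hinc : ∀ j, StrictMono (c j))
    (hmarg : ∀ j, StrictlyIncreasingMarginalCost (c j))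
    (Jstar : Finset α → ℝ)
    (hJstar : ∀ T : Finset α, T ⊆ Z → T.Nonempty →
      IsLeast {r : ℝ | ∃ p : α → ℕ, IsAlloc T M p ∧ r = allocCost c T p} (Jstar T))
    (L : Finset α) (hLZ : L ⊆ Z)
    (K : Finset α) (hKL : K ⊆ L)
    (hLK : (L \ K).Nonempty)
    (hLj : ∀ j ∈ K, (L.erase j).Nonempty) :
    ∑ j ∈ K, (Jstar (L.erase j) - Jstar L) ≤ Jstar (L \ K) - Jstar L := by
  have hLne : L.Nonempty := hLK.mono Finset.sdiff_subset
  have HL := hJstar L hLZ hLne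
  have HS := hJstar (L \ K) (Finset.sdiff_subset.trans hLZ) hLK
  obtain ⟨p, ⟨-, hpM⟩, hpJ⟩ := HL.1
  obtain ⟨q0, ⟨-, hqM⟩, hqJ⟩ := HS.1
  unfold allocCost at hpJ hqJ
  -- total is exactly M
  have hpEq : ∑ j ∈ L, p j = M := by
    by_contra hne
    have hgt : M < ∑ j ∈ L, p j := lt_of_le_of_ne hpM (Ne.symm hne)
    obtain ⟨i, hi, hpi⟩ := Finset.exists_ne_zero_of_sum_ne_zero
      (show ∑ j ∈ L, p j ≠ 0 by omega)
    obtain ⟨x, hx⟩ := Nat.exists_eq_succ_of_ne_zero hpi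
    have e1 := CoreAux.sum_upd L (fun _ z => z) p i hi x
    have e2 := CoreAux.sum_upd L c p i hi x
    try simp only at e1
    have := CoreAux.least_le HL (Function.update p i x) (by omega)
    have h3 := hinc i (show x < p i by omega)
    linarith
  have hex : ∀ i ∈ L, ∀ k ∈ L, k ≠ i → ∀ x, p i = x + 1 →
      c i (x + 1) - c i x ≤ c k (p k + 1) - c k (p k) := by
    intro i hi k hk hki x hx
    have e1 := CoreAux.sum_upd2 L (fun _ z => z) p i k hi hk hki x (p k + 1)
    have e2 := CoreAux.sum_upd2 L c p i k hi hk hki x (p k + 1)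
    try simp only at e1
    have := CoreAux.least_le HL (Function.update (Function.update p i x) k (p k + 1)) (by omega)
    rw [hx] at e2
    linarith
  have hsplit : ∀ g : α → ℕ, ∑ j ∈ L \ K, g j + ∑ j ∈ K, g j = ∑ j ∈ L, g j :=
    fun g => Finset.sum_sdiff hKL
  have hp2 := hsplit p
  obtain ⟨q, hq1, hq2, hq3⟩ := CoreAux.exists_dom c hmarg (L \ K) M p (by omega)
    (fun i hi k hk => hex i (Finset.sdiff_subset hi) k (Finset.sdiff_subset hk)) _ q0 hqM rfl
  have hD : ∑ i ∈ L \ K, (q i - p i) + ∑ i ∈ L \ K, p i = ∑ i ∈ L \ K, q i := by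
    rw [← Finset.sum_add_distrib]
    exact Finset.sum_congr rfl fun i hi => Nat.sub_add_cancel (hq2 i hi)
  obtain ⟨d, hd1, hd2⟩ := CoreAux.exists_split (L \ K) K p (fun i => q i - p i) (by omega)
  have key : ∀ j ∈ K, Jstar (L.erase j) - Jstar L ≤
      ∑ i ∈ L \ K, (c i (p i + d j i) - c i (p i)) - c j (p j) := by
    intro j hj
    have hjL := hKL hj
    have HJ := hJstar (L.erase j) ((Finset.erase_subset _ _).trans hLZ) (hLj j hj)
    set w : α → ℕ := fun i => if i ∈ K then p i else p i + d j i with hw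
    have hsub : L \ K ⊆ L.erase j := fun i hi => by
      rw [Finset.mem_sdiff] at hi
      exact Finset.mem_erase.2 ⟨fun h => hi.2 (h ▸ hj), hi.1⟩
    have hwK : ∀ i ∈ K, w i = p i := fun i hi => by simp [hw, hi]
    have hwS : ∀ i ∈ L \ K, w i = p i + d j i := fun i hi => by
      simp [hw, (Finset.mem_sdiff.1 hi).2]
    have hN : ∑ i ∈ L, w i = ∑ i ∈ L, p i + p j := by
      rw [← hsplit w, (Finset.sum_congr rfl hwK : ∑ i ∈ K, w i = ∑ i ∈ K, p i), Finset.sum_congr rfl hwS,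
        Finset.sum_add_distrib, hd1 j hj, ← hp2]
      omega
    have hN2 := Finset.add_sum_erase L w hjL
    rw [hwK j hj] at hN2
    have hle := CoreAux.least_le HJ w (by omega)
    have hC2 := Finset.add_sum_erase L (fun i => c i (w i)) hjL
    have hC : ∑ i ∈ L, c i (w i) - ∑ i ∈ L, c i (p i)
        = ∑ i ∈ L \ K, (c i (p i + d j i) - c i (p i)) := by
      rw [← Finset.sum_sdiff hKL, ← Finset.sum_sdiff (f := fun i => c i (p i)) hKL,
        Finset.sum_sub_distrib,
        Finset.sum_congr rfl (fun i hi => by rw [hwK i hi] : ∀ i ∈ K, c i (w i) = c i (p i)),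
        Finset.sum_congr rfl
          (fun i hi => by rw [hwS i hi] : ∀ i ∈ L \ K, c i (w i) = c i (p i + d j i))]
      ring
    simp only [hwK j hj] at hC2
    linarith
  have h1 := Finset.sum_le_sum key
  rw [Finset.sum_sub_distrib (s := K) (f := fun j => ∑ i ∈ L \ K, (c i (p i + d j i) - c i (p i))),
    Finset.sum_comm] at h1
  have h2 : ∑ i ∈ L \ K, ∑ j ∈ K, (c i (p i + d j i) - c i (p i))
      ≤ ∑ i ∈ L \ K, (c i (q i) - c i (p i)) := by
    apply Finset.sum_le_sum
    intro i hi
    refine (CoreAux.superadd_sum (hmarg i) (p i) K (fun j => d j i)).trans ?_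
    have a1 := hd2 i
    have a2 := hq2 i hi
    have := (hinc i).monotone (show p i + ∑ j ∈ K, d j i ≤ q i by omega)
    linarith
  rw [Finset.sum_sub_distrib] at h2
  have h3 : ∑ i ∈ L \ K, c i (p i) + ∑ i ∈ K, c i (p i) = ∑ i ∈ L, c i (p i) :=
    Finset.sum_sdiff hKL
  linarith
end
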